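/- Let 𝒢 = (G, γ, (≺_i)_{1≤i≤h}) be an ordered level graph and let S be a sweeping sequence for 𝒢 that uses every edge of G. Then 𝒢 admits an ordered level planar drawing. -/

import Mathlib

open scoped Classical

/-- A level graph: a finite directed graph with a surjective level assignment
`lvl : V → {1, …, h}` such that edges go strictly upwards. -/
structure OrderedLevelGraph (V : Type) [Fintype V] where
  h : ℕ
  Edge : V → V → Prop
  lvl : V → ℕ
  lvl_one_le : ∀ v, 1 ≤ lvl v
  lvl_le : ∀ v, lvl v ≤ h
  lvl_surj : ∀ i, 1 ≤ i → i ≤ h → ∃ v, lvl v = i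
  edge_lt : ∀ u v, Edge u v → lvl u < lvl v
  /-- the total order `≺ᵢ` on each level -/
  prec : ℕ → V → V → Prop
  prec_lvl : ∀ i u v, prec i u v → lvl u = i ∧ lvl v = i
  prec_irrefl : ∀ i v, ¬ prec i v v
  prec_trans : ∀ i a b c, prec i a b → prec i b c → prec i a c
  prec_total : ∀ i u v, lvl u = i → lvl v = i → u ≠ v → prec i u v ∨ prec i v u

/-- An ordered level planar drawing: x-coordinates for the vertices, a y-monotone
curve (given by its x-coordinate `f u v t` at height `t`) for every edge, no
crossings, edges pass through no non-incident vertices, and the left-to-right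
order on each level agrees with `≺ᵢ`. -/
structure OLPDrawing {V : Type} [Fintype V] (G : OrderedLevelGraph V) where
  x : V → ℝ
  f : V → V → ℝ → ℝ
  x_inj : ∀ u v, G.lvl u = G.lvl v → x u = x v → u = v
  f_cont : ∀ u v, G.Edge u v → ContinuousOn (f u v) (Set.Icc (G.lvl u : ℝ) (G.lvl v : ℝ))
  f_src : ∀ u v, G.Edge u v → f u v (G.lvl u : ℝ) = x u
  f_tgt : ∀ u v, G.Edge u v → f u v (G.lvl v : ℝ) = x v
  planar : ∀ u v u' v', G.Edge u v → G.Edge u' v' → (u, v) ≠ (u', v') →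
    ∀ t : ℝ, t ∈ Set.Icc (G.lvl u : ℝ) (G.lvl v : ℝ) →
      t ∈ Set.Icc (G.lvl u' : ℝ) (G.lvl v' : ℝ) → f u v t = f u' v' t →
      ∃ w, (w = u ∨ w = v) ∧ (w = u' ∨ w = v') ∧ t = (G.lvl w : ℝ) ∧ f u v t = x w
  no_through : ∀ u v w, G.Edge u v → w ≠ u → w ≠ v →
    G.lvl u ≤ G.lvl w → G.lvl w ≤ G.lvl v → f u v (G.lvl w : ℝ) ≠ x w
  prec_ok : ∀ i u v, G.prec i u v → x u < x v

variable {V : Type} [Fintype V]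

/-- `λᵢ`, the number of vertices on level `i`. -/
noncomputable def lam (G : OrderedLevelGraph V) (i : ℕ) : ℕ := Nat.card {v : V // G.lvl v = i}

/-- The (odd) position index representing vertex `v` on its level:
`2·rank(v) + 1`, where `rank v` is the number of vertices preceding `v`
in the total order of its level. -/
noncomputable def idx (G : OrderedLevelGraph V) (v : V) : ℕ :=
  2 * Nat.card {u : V // G.prec (G.lvl v) u v} + 1

/-- A separation: a choice of a position index on every level. -/
def IsSep (G : OrderedLevelGraph V) (s : ℕ → ℕ) : Prop := ∀ i, s i ≤ 2 * lam G i

/-- Vertex `v` is on the separation `s`. -/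
def OnSep (G : OrderedLevelGraph V) (s : ℕ → ℕ) (v : V) : Prop := s (G.lvl v) = idx G v

/-- `u` and `v` (with `lvl u < lvl v`) are consecutive on `s`: both are on `s`
and all intermediate levels carry a gap (an even index). -/
def ConsecOn (G : OrderedLevelGraph V) (s : ℕ → ℕ) (u v : V) : Prop :=
  OnSep G s u ∧ OnSep G s v ∧ G.lvl u < G.lvl v ∧
    ∀ j, G.lvl u < j → j < G.lvl v → s j % 2 = 0

/-- The separation `s` uses the edge `(u, v)`. -/
def UsesEdge (G : OrderedLevelGraph V) (s : ℕ → ℕ) (u v : V) : Prop :=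
  G.Edge u v ∧ ConsecOn G s u v

/-- A sweeping sequence: a finite sequence of separations that is
componentwise nondecreasing. -/
def IsSweep (G : OrderedLevelGraph V) (S : List (ℕ → ℕ)) : Prop :=
  (∀ s ∈ S, IsSep G s) ∧ S.Chain' fun s s' => ∀ i, s i ≤ s' i

/-- A sequence of separations is nice if each member arises from its
predecessor by incrementing exactly one component by 1. -/
def IsNice (S : List (ℕ → ℕ)) : Prop :=
  S.Chain' fun s s' => ∃ j, s' j = s j + 1 ∧ ∀ i, i ≠ j → s' i = s i

theorem idx_lt_of_prec (G : OrderedLevelGraph V) {i : ℕ} {u v : V} (h : G.prec i u v) :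
    idx G u < idx G v := by
  obtain ⟨hu, hv⟩ := G.prec_lvl i u v h
  have key : Set.ncard {w : V | G.prec i w u} < Set.ncard {w : V | G.prec i w v} := by
    apply Set.ncard_lt_ncard _ (Set.toFinite _)
    refine ⟨fun w hw => G.prec_trans i w u v hw h, fun hsub => ?_⟩
    exact G.prec_irrefl i u (hsub h)
  have key' : Nat.card {w : V // G.prec i w u} < Nat.card {w : V // G.prec i w v} := key
  unfold idx
  rw [hu, hv]
  omega

theorem idx_inj (G : OrderedLevelGraph V) {u v : V} (hl : G.lvl u = G.lvl v)
    (h : idx G u = idx G v) : u = v := by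
  by_contra hne
  rcases G.prec_total (G.lvl v) u v hl rfl hne with h' | h' <;>
    have := idx_lt_of_prec G h' <;> omega

theorem idx_odd (G : OrderedLevelGraph V) (v : V) : idx G v % 2 = 1 := by
  unfold idx
  omega

/-- The abscissa of the `g`-th separation `s` on level `i`: inside a gap, later separations are
shifted slightly further to the right, by less than one unit. -/
noncomputable def sepX (g : ℕ) (s : ℕ → ℕ) (i : ℕ) : ℝ :=
  s i + if s i % 2 = 0 then (g : ℝ) / (g + 1) else 0

theorem sepX_of_odd {g : ℕ} {s : ℕ → ℕ} {i : ℕ} (h : s i % 2 = 1) : sepX g s i = s i := by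
  simp [sepX, h]

theorem shift_nonneg (g : ℕ) : (0 : ℝ) ≤ (g : ℝ) / (g + 1) := by positivity

theorem shift_lt_one (g : ℕ) : (g : ℝ) / (g + 1) < 1 := by
  rw [div_lt_one (by positivity)]
  linarith

theorem shift_lt_shift {g g' : ℕ} (h : g < g') : (g : ℝ) / (g + 1) < (g' : ℝ) / (g' + 1) := by
  have : (g : ℝ) < g' := by exact_mod_cast h
  rw [div_lt_div_iff₀ (by positivity) (by positivity)]
  nlinarith

theorem le_sepX (g : ℕ) (s : ℕ → ℕ) (i : ℕ) : (s i : ℝ) ≤ sepX g s i := by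
  unfold sepX
  split_ifs <;> linarith [shift_nonneg g]

theorem sepX_lt (g : ℕ) (s : ℕ → ℕ) (i : ℕ) : sepX g s i < s i + 1 := by
  unfold sepX
  split_ifs <;> linarith [shift_lt_one g]

theorem sepX_lt_sepX {g g' : ℕ} {s s' : ℕ → ℕ} {i : ℕ} (h : s i < s' i) :
    sepX g s i < sepX g' s' i := by
  have : (s i : ℝ) + 1 ≤ s' i := by exact_mod_cast h
  linarith [sepX_lt g s i, le_sepX g' s' i]

theorem sepX_mono {g g' : ℕ} {s s' : ℕ → ℕ} (hg : g < g') (hs : ∀ i, s i ≤ s' i) (i : ℕ) :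
    sepX g s i ≤ sepX g' s' i := by
  rcases (hs i).lt_or_eq with h | h
  · exact (sepX_lt_sepX h).le
  · unfold sepX
    rw [h]
    split_ifs <;> linarith [shift_lt_shift hg]

theorem eq_odd_of_sepX_eq {g g' : ℕ} {s s' : ℕ → ℕ} {i : ℕ} (hg : g < g')
    (hs : ∀ i, s i ≤ s' i) (h : sepX g s i = sepX g' s' i) : s i = s' i ∧ s i % 2 = 1 := by
  have heq : s i = s' i := by
    rcases (hs i).lt_or_eq with hlt | heq
    · exact absurd h (sepX_lt_sepX hlt).ne
    · exact heq
  refine ⟨heq, ?_⟩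
  by_contra hne
  have h0 : s' i % 2 = 0 := by omega
  unfold sepX at h
  rw [heq, if_pos h0, if_pos h0] at h
  linarith [shift_lt_shift hg]

/-- The piecewise linear function with value `X i` at each integer `i ≤ n`, written as a
combination of hat functions. -/
noncomputable def interp (n : ℕ) (X : ℕ → ℝ) (t : ℝ) : ℝ :=
  ∑ i ∈ Finset.range (n + 1), X i * max 0 (1 - |t - i|)

theorem continuous_interp (n : ℕ) (X : ℕ → ℝ) : Continuous (interp n X) := by
  unfold interp
  fun_prop

theorem interp_natCast {n k : ℕ} (X : ℕ → ℝ) (hk : k ≤ n) : interp n X k = X k := by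
  unfold interp
  rw [Finset.sum_eq_single k]
  · simp
  · intro i _ hik
    have h1 : (1 : ℝ) ≤ |(k : ℝ) - i| := by
      have : (1 : ℤ) ≤ |(k : ℤ) - i| := Int.one_le_abs (by omega)
      exact_mod_cast this
    rw [max_eq_left (by linarith), mul_zero]
  · intro h
    exact absurd (Finset.mem_range.2 (by omega)) h

theorem eq_of_interp_eq {n : ℕ} {X Y : ℕ → ℝ} {t : ℝ} (hXY : ∀ i, X i ≤ Y i)
    (h : interp n X t = interp n Y t) {i : ℕ} (hi : i ≤ n) (hit : |t - i| < 1) : X i = Y i := by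
  have hle : ∀ i ∈ Finset.range (n + 1),
      X i * max 0 (1 - |t - i|) ≤ Y i * max 0 (1 - |t - i|) := fun i _ =>
    mul_le_mul_of_nonneg_right (hXY i) (le_max_left _ _)
  have := (Finset.sum_eq_sum_iff_of_le hle).1 h i (Finset.mem_range.2 (by omega))
  have hpos : 0 < max 0 (1 - |t - i|) := lt_max_of_lt_right (by linarith)
  exact mul_right_cancel₀ hpos.ne' this

theorem ConsecOn.odd_src {G : OrderedLevelGraph V} {s : ℕ → ℕ} {u v : V}
    (h : ConsecOn G s u v) : s (G.lvl u) % 2 = 1 := by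
  rw [show s (G.lvl u) = idx G u from h.1]
  exact idx_odd G u

theorem ConsecOn.odd_tgt {G : OrderedLevelGraph V} {s : ℕ → ℕ} {u v : V}
    (h : ConsecOn G s u v) : s (G.lvl v) % 2 = 1 := by
  rw [show s (G.lvl v) = idx G v from h.2.1]
  exact idx_odd G v

theorem OnSep.eq_of_lvl_eq {G : OrderedLevelGraph V} {s s' : ℕ → ℕ} {w w' : V}
    (h : OnSep G s w) (h' : OnSep G s' w') (hl : G.lvl w = G.lvl w')
    (hs : s (G.lvl w) = s' (G.lvl w)) : w = w' := by
  apply idx_inj G hl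
  rw [← show s (G.lvl w) = idx G w from h, ← show s' (G.lvl w') = idx G w' from h', hs, hl]

theorem ConsecOn.lvl_eq_of_odd {G : OrderedLevelGraph V} {s : ℕ → ℕ} {u v : V}
    (h : ConsecOn G s u v) {i : ℕ} (hu : G.lvl u ≤ i) (hv : i ≤ G.lvl v) (hi : s i % 2 = 1) :
    G.lvl u = i ∨ G.lvl v = i := by
  by_contra! hne
  have := h.2.2.2 i (by omega) (by omega)
  omega

theorem ConsecOn.exists_of_odd {G : OrderedLevelGraph V} {s : ℕ → ℕ} {u v : V}
    (h : ConsecOn G s u v) {i : ℕ} (hu : G.lvl u ≤ i) (hv : i ≤ G.lvl v) (hi : s i % 2 = 1) :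
    ∃ w, (w = u ∨ w = v) ∧ G.lvl w = i ∧ OnSep G s w := by
  rcases h.lvl_eq_of_odd hu hv hi with hw | hw
  · exact ⟨u, Or.inl rfl, hw, h.1⟩
  · exact ⟨v, Or.inr rfl, hw, h.2.1⟩

/-- Edges on one separation overlap at most in a common endpoint. -/
theorem exists_common_of_same_sep {G : OrderedLevelGraph V} {s : ℕ → ℕ} {u v u' v' : V}
    (h : ConsecOn G s u v) (h' : ConsecOn G s u' v') (hne : (u, v) ≠ (u', v')) {t : ℝ}
    (ht : t ∈ Set.Icc (G.lvl u : ℝ) (G.lvl v : ℝ))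
    (ht' : t ∈ Set.Icc (G.lvl u' : ℝ) (G.lvl v' : ℝ)) :
    ∃ w, (w = u ∨ w = v) ∧ (w = u' ∨ w = v') ∧ t = (G.lvl w : ℝ) := by
  have a := h.2.2.2 (G.lvl u')
  have b := h.2.2.2 (G.lvl v')
  have a' := h'.2.2.2 (G.lvl u)
  have b' := h'.2.2.2 (G.lvl v)
  have := h.odd_src
  have := h.odd_tgt
  have := h'.odd_src
  have := h'.odd_tgt
  have := h.2.2.1
  have := h'.2.2.1
  have hc : G.lvl v ≤ G.lvl u' ∨ G.lvl v' ≤ G.lvl u ∨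
      (G.lvl u = G.lvl u' ∧ G.lvl v = G.lvl v') := by omega
  rcases hc with hc | hc | ⟨hu, hv⟩
  · have hcr : (G.lvl v : ℝ) ≤ G.lvl u' := by exact_mod_cast hc
    have e : (G.lvl v : ℝ) = G.lvl u' := le_antisymm hcr (ht'.1.trans ht.2)
    have e' : G.lvl v = G.lvl u' := by exact_mod_cast e
    exact ⟨v, Or.inr rfl, Or.inl (h.2.1.eq_of_lvl_eq h'.1 e' rfl),
      le_antisymm ht.2 (hcr.trans ht'.1)⟩
  · have hcr : (G.lvl v' : ℝ) ≤ G.lvl u := by exact_mod_cast hc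
    have e : (G.lvl u : ℝ) = G.lvl v' := le_antisymm (ht.1.trans ht'.2) hcr
    have e' : G.lvl u = G.lvl v' := by exact_mod_cast e
    exact ⟨u, Or.inl rfl, Or.inr (h.1.eq_of_lvl_eq h'.2.1 e' rfl),
      le_antisymm (ht'.2.trans hcr) ht.1⟩
  · exact absurd (Prod.ext (h.1.eq_of_lvl_eq h'.1 hu rfl) (h.2.1.eq_of_lvl_eq h'.2.1 hv rfl)) hne

/-- Edges on distinct separations meet at most in a common endpoint. -/
theorem exists_common_of_lt {G : OrderedLevelGraph V} {g g' : ℕ} {s s' : ℕ → ℕ} {u v u' v' : V}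
    (hg : g < g') (hs : ∀ i, s i ≤ s' i)
    (h : ConsecOn G s u v) (h' : ConsecOn G s' u' v') (hne : (u, v) ≠ (u', v')) {t : ℝ}
    (ht : t ∈ Set.Icc (G.lvl u : ℝ) (G.lvl v : ℝ))
    (ht' : t ∈ Set.Icc (G.lvl u' : ℝ) (G.lvl v' : ℝ))
    (heq : interp G.h (sepX g s) t = interp G.h (sepX g' s') t) :
    ∃ w, (w = u ∨ w = v) ∧ (w = u' ∨ w = v') ∧ t = (G.lvl w : ℝ) := by
  have ht0 : (0 : ℝ) ≤ t := (Nat.cast_nonneg _).trans ht.1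
  have meet : ∀ i : ℕ, i ≤ G.lvl v → |t - i| < 1 → s i = s' i ∧ s i % 2 = 1 := fun i hi hit =>
    eq_odd_of_sepX_eq hg hs
      (eq_of_interp_eq (sepX_mono hg hs) heq (hi.trans (G.lvl_le v)) hit)
  obtain ⟨i, hi⟩ : ∃ i, i = ⌊t⌋₊ := ⟨_, rfl⟩
  have hit : (i : ℝ) ≤ t := hi ▸ Nat.floor_le ht0
  have hti : t < i + 1 := hi ▸ Nat.lt_floor_add_one t
  have hu : G.lvl u ≤ i := hi ▸ Nat.le_floor ht.1
  have hu' : G.lvl u' ≤ i := hi ▸ Nat.le_floor ht'.1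
  have hv : i ≤ G.lvl v := by exact_mod_cast hit.trans ht.2
  have hv' : i ≤ G.lvl v' := by exact_mod_cast hit.trans ht'.2
  obtain ⟨e, o⟩ := meet i hv (by rw [abs_lt]; constructor <;> linarith)
  rcases hit.eq_or_lt with hit | hit
  · obtain ⟨w, hw, hwi, hws⟩ := h.exists_of_odd hu hv o
    obtain ⟨w', hw', hwi', hws'⟩ := h'.exists_of_odd hu' hv' (e ▸ o)
    have : w = w' := hws.eq_of_lvl_eq hws' (hwi.trans hwi'.symm) (by rw [hwi, e])
    subst this
    exact ⟨w, hw, hw', by rw [hwi, hit]⟩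
  · have hv1 : i + 1 ≤ G.lvl v := by exact_mod_cast hit.trans_le ht.2
    have hv1' : i + 1 ≤ G.lvl v' := by exact_mod_cast hit.trans_le ht'.2
    obtain ⟨e1, o1⟩ := meet (i + 1) hv1 (by
      push_cast
      rw [abs_lt]
      constructor <;> linarith)
    have := h.lvl_eq_of_odd hu hv o
    have := h'.lvl_eq_of_odd hu' hv' (e ▸ o)
    have := h.lvl_eq_of_odd (by omega) hv1 o1
    have := h'.lvl_eq_of_odd (by omega) hv1' (e1 ▸ o1)
    have lu : G.lvl u = i := by omega
    have lv : G.lvl v = i + 1 := by omega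
    exact absurd (Prod.ext (h.1.eq_of_lvl_eq h'.1 (by omega) (by rw [lu, e]))
      (h.2.1.eq_of_lvl_eq h'.2.1 (by omega) (by rw [lv, e1]))) hne

/-- If there is a sweeping sequence for an ordered level graph
that uses every edge, then the graph admits an ordered level planar drawing. -/
theorem olp_of_sweep (G : OrderedLevelGraph V) (S : List (ℕ → ℕ))
    (hS : IsSweep G S) (hall : ∀ u v, G.Edge u v → ∃ s ∈ S, UsesEdge G s u v) :
    Nonempty (OLPDrawing G) := by
  have hmono : S.Pairwise fun s s' => ∀ i, s i ≤ s' i :=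
    haveI : IsTrans (ℕ → ℕ) fun s s' => ∀ i, s i ≤ s' i :=
      ⟨fun _ _ _ h h' i => (h i).trans (h' i)⟩
    List.isChain_iff_pairwise.1 hS.2
  have hex : ∀ u v, ∃ (j : ℕ) (s : ℕ → ℕ), G.Edge u v → S[j]? = some s ∧ ConsecOn G s u v := by
    intro u v
    by_cases he : G.Edge u v
    · obtain ⟨s, hs, hu⟩ := hall u v he
      obtain ⟨j, hj⟩ := List.mem_iff_getElem?.1 hs
      exact ⟨j, s, fun _ => ⟨hj, hu.2⟩⟩
    · exact ⟨0, fun _ => 0, fun h => absurd h he⟩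
  choose J s hJ using hex
  have hle : ∀ u v u' v', G.Edge u v → G.Edge u' v' → J u v < J u' v' →
      ∀ i, s u v i ≤ s u' v' i := by
    intro u v u' v' he he' hlt
    obtain ⟨h1, e1⟩ := List.getElem?_eq_some_iff.1 (hJ u v he).1
    obtain ⟨h2, e2⟩ := List.getElem?_eq_some_iff.1 (hJ u' v' he').1
    rw [← e1, ← e2]
    exact List.pairwise_iff_getElem.1 hmono _ _ h1 h2 hlt
  have hval : ∀ u v, ∀ w, interp G.h (sepX (J u v) (s u v)) (G.lvl w : ℝ) =
      sepX (J u v) (s u v) (G.lvl w) := fun u v w => interp_natCast _ (G.lvl_le w)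
  have hon : ∀ u v w, OnSep G (s u v) w →
      interp G.h (sepX (J u v) (s u v)) (G.lvl w : ℝ) = (idx G w : ℝ) := by
    intro u v w hw
    have hw' : s u v (G.lvl w) = idx G w := hw
    rw [hval, sepX_of_odd (hw' ▸ idx_odd G w), hw']
  refine ⟨{
    x := fun v => idx G v
    f := fun u v => interp G.h (sepX (J u v) (s u v))
    x_inj := fun u v hl h => idx_inj G hl (by exact_mod_cast h)
    f_cont := fun u v _ => (continuous_interp _ _).continuousOn
    f_src := fun u v he => hon u v u (hJ u v he).2.1
    f_tgt := fun u v he => hon u v v (hJ u v he).2.2.1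
    planar := ?_
    no_through := ?_
    prec_ok := fun i u v h => by exact_mod_cast idx_lt_of_prec G h }⟩
  · intro u v u' v' he he' hne t ht ht' heq
    have c := (hJ u v he).2
    have c' := (hJ u' v' he').2
    have hw : ∃ w, (w = u ∨ w = v) ∧ (w = u' ∨ w = v') ∧ t = (G.lvl w : ℝ) := by
      rcases lt_trichotomy (J u v) (J u' v') with hlt | hJeq | hlt
      · exact exists_common_of_lt hlt (hle _ _ _ _ he he' hlt) c c' hne ht ht' heq
      · have hs : s u v = s u' v' := Option.some_injective _
          ((hJ u v he).1.symm.trans ((congrArg (S[·]?) hJeq).trans (hJ u' v' he').1))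
        exact exists_common_of_same_sep c (hs ▸ c') hne ht ht'
      · obtain ⟨w, h1, h2, h3⟩ :=
          exists_common_of_lt hlt (hle _ _ _ _ he' he hlt) c' c hne.symm ht' ht heq.symm
        exact ⟨w, h2, h1, h3⟩
    obtain ⟨w, h1, h2, rfl⟩ := hw
    refine ⟨w, h1, h2, rfl, hon u v w ?_⟩
    rcases h1 with rfl | rfl
    exacts [c.1, c.2.1]
  · intro u v w he hwu hwv hu hv heq
    have c := (hJ u v he).2
    rw [hval] at heq
    have h1 := le_sepX (J u v) (s u v) (G.lvl w)
    have h2 := sepX_lt (J u v) (s u v) (G.lvl w)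
    rw [heq] at h1 h2
    have h3 : s u v (G.lvl w) = idx G w := by
      have h1' : s u v (G.lvl w) ≤ idx G w := by exact_mod_cast h1
      have h2' : idx G w < s u v (G.lvl w) + 1 := by exact_mod_cast h2
      omega
    obtain ⟨w', hw', hl, ho⟩ := c.exists_of_odd hu hv (h3 ▸ idx_odd G w)
    have : w' = w := OnSep.eq_of_lvl_eq ho h3 hl rfl
    subst this
    exact hw'.elim hwu hwv
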